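/- arXiv:2506.00939 — 11 statements merged into one kernel-verified Lean document; each statement's English description precedes it below -/
import Mathlib

section
/- Let β, T_max, δ, α, ρ, μ, c be positive real numbers and define the cubic polynomial CP_M(λ) = [βρT_max − (ρ+μ+δ+λ)(c+λ)](δ+λ) + βT_max·α·ρ. Then every complex root of CP_M has strictly negative real part if and only if 𝓡 < 1, where 𝓡 = βT_max(α+δ)ρ/(δc(δ+μ+ρ)). -/
theorem aux_norm (a : ℝ) (z : ℂ) (hz : 0 ≤ z.re) : a ≤ ‖(a : ℂ) + z‖ := by
  have h := Complex.re_le_norm ((a : ℂ) + z)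
  simp at h
  linarith

/-- Routh–Hurwitz criterion for the cubic factor `CP_M` of the characteristic polynomial of
the Jacobian at the uninfected equilibrium: every complex root has negative real part iff the
basic reproduction number `𝓡 < 1`. -/
theorem stmt_1 (β Tmax δ α ρ μ c : ℝ)
    (hβ : 0 < β) (hT : 0 < Tmax) (hδ : 0 < δ) (hα : 0 < α)
    (hρ : 0 < ρ) (hμ : 0 < μ) (hc : 0 < c) :
    (∀ lam : ℂ,
        (((β : ℂ) * (ρ : ℂ) * (Tmax : ℂ)
            - ((ρ : ℂ) + (μ : ℂ) + (δ : ℂ) + lam) * ((c : ℂ) + lam)) * ((δ : ℂ) + lam)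
          + (β : ℂ) * (Tmax : ℂ) * (α : ℂ) * (ρ : ℂ) = 0 → lam.re < 0))
      ↔ β * Tmax * (α + δ) * ρ / (δ * c * (δ + μ + ρ)) < 1 := by
  have hD : 0 < δ * c * (δ + μ + ρ) := by positivity
  rw [div_lt_one hD]
  have hk : 0 < β * ρ * Tmax := by positivity
  constructor
  · intro H
    by_contra hR
    push Not at hR
    set k := β * ρ * Tmax with hkdef
    let f : ℝ → ℝ := fun x => (ρ + μ + δ + x) * (c + x) * (δ + x) - k * (δ + x) - k * α
    have hf : ContinuousOn f (Set.Icc 0 (k + α + 1)) := by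
      apply Continuous.continuousOn
      fun_prop
    have h0 : f 0 ≤ 0 := by
      simp only [f, hkdef]
      nlinarith
    have h1 : 0 ≤ f (k + α + 1) := by
      simp only [f]
      set X := k + α + 1 with hX
      have hXp : 0 < X := by positivity
      have e1 : X * X ≤ (ρ + μ + δ + X) * (c + X) := by gcongr <;> linarith
      have e2 : k + k * α ≤ X * X := by rw [hX]; nlinarith [mul_pos hk hα]
      have e3 : (k + k * α) * (δ + X) ≤ (ρ + μ + δ + X) * (c + X) * (δ + X) := by
        gcongr; linarith
      have e4 : k * α * 1 ≤ k * α * (δ + X) := by gcongr; linarith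
      linarith
    obtain ⟨x, hx, hfx⟩ := intermediate_value_Icc (by positivity) hf ⟨h0, h1⟩
    have := H (x : ℂ) (by
      have h2 : (β * ρ * Tmax - (ρ + μ + δ + x) * (c + x)) * (δ + x)
          + β * Tmax * α * ρ = 0 := by
        simp only [f, hkdef] at hfx
        linarith
      exact_mod_cast h2)
    simp at this
    linarith [hx.1]
  · intro hR z hz
    by_contra hn
    push Not at hn
    have n1 := aux_norm (ρ + μ + δ) z hn
    have n2 := aux_norm c z hn
    have n3 := aux_norm δ z hn
    have e : (((ρ + μ + δ : ℝ) : ℂ) + z) * ((c : ℂ) + z) * ((δ : ℂ) + z) * (δ : ℂ)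
        = ((β * ρ * Tmax : ℝ) : ℂ) * ((δ : ℂ) * ((δ : ℂ) + z) + ((α * δ : ℝ) : ℂ)) := by
      push_cast
      linear_combination (-(δ : ℂ)) * hz
    have e' := congrArg norm e
    have t := norm_add_le ((δ : ℂ) * ((δ : ℂ) + z)) ((α * δ : ℝ) : ℂ)
    rw [norm_mul, norm_mul, norm_mul, norm_mul, Complex.norm_of_nonneg hk.le,
      Complex.norm_of_nonneg hδ.le] at e'
    rw [norm_mul, Complex.norm_of_nonneg hδ.le, Complex.norm_of_nonneg (by positivity)] at t
    set A := ‖((ρ + μ + δ : ℝ) : ℂ) + z‖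
    set B := ‖(c : ℂ) + z‖
    set C := ‖(δ : ℂ) + z‖
    have hC : 0 < C := by linarith
    have s1 : (ρ + μ + δ) * c * C * δ ≤ A * B * C * δ := by gcongr
    have s2 := mul_le_mul_of_nonneg_left t hk.le
    have s3 : β * ρ * Tmax * (δ * C + α * δ) ≤ β * ρ * Tmax * (δ * C + α * C) := by gcongr
    have s4 := mul_lt_mul_of_pos_right hR hC
    linarith
end

section
/- Let γ, T_max, β, η, δ, α, ρ, μ, c be positive reals with ηγ > δ, and let V† = ρα(ηγ−δ)T_max/(ηγ·c·(ρ+μ+δ)). Then δ/η − βV† < 0 if and only if 𝓡 > 𝓡†, where 𝓡 = βT_max(α+δ)ρ/(δc(δ+μ+ρ)) and 𝓡† = (1/(γη))·(γ + (ρβT_max/(c(ρ+μ+δ)))·(α + γη)). -/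
/-- Stability threshold of the total infection equilibrium: the eigenvalue `δ/η − βV†` is
negative iff `𝓡 > 𝓡†`. -/
theorem stmt_3 (γ Tmax β η δ α ρ μ c : ℝ)
    (hγ : 0 < γ) (hT : 0 < Tmax) (hβ : 0 < β) (hη : 0 < η) (hδ : 0 < δ)
    (hα : 0 < α) (hρ : 0 < ρ) (hμ : 0 < μ) (hc : 0 < c)
    (hηγ : η * γ > δ)
    (Vdag : ℝ)
    (hV : Vdag = ρ * α * (η * γ - δ) * Tmax / (η * γ * c * (ρ + μ + δ))) :
    δ / η - β * Vdag < 0 ↔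
      β * Tmax * (α + δ) * ρ / (δ * c * (δ + μ + ρ)) >
        (1 / (γ * η)) * (γ + (ρ * β * Tmax / (c * (ρ + μ + δ))) * (α + γ * η)) := by
  have hS : 0 < ρ + μ + δ := by positivity
  have hS' : δ + μ + ρ = ρ + μ + δ := by ring
  have key : δ / η - β * Vdag =
      -(δ * (β * Tmax * (α + δ) * ρ / (δ * c * (δ + μ + ρ)) -
        (1 / (γ * η)) * (γ + (ρ * β * Tmax / (c * (ρ + μ + δ))) * (α + γ * η)))) := by
    rw [hV, hS']
    generalize ρ + μ + δ = S at hS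
    field_simp
    ring
  rw [key, neg_lt_zero, mul_pos_iff_of_pos_left hδ, sub_pos]
end

section
/- Let γ, T_max, β, η, δ, ζ, α, ρ, μ, c be positive reals. Suppose (T*, I*, R*, V*) is an equilibrium of the logistic multiscale HCV model (all four right-hand sides vanish) with T* > 0 and M(T*) ≠ B, where M(T) = ζρβT − (ρ+μ+δ)c and B = αρβT_max/γ. Then I*/T_max = (1 − T*/T_max)·M(T*)/(M(T*) − B). -/
/-- At any equilibrium of the logistic multiscale HCV model with `T* > 0` and `M(T*) ≠ B`,
the infected-cell fraction satisfies `I*/T_max = (1 − T*/T_max)·M(T*)/(M(T*) − B)`. -/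
theorem stmt_4 (γ Tmax β η δ ζ α ρ μ c : ℝ)
    (hγ : 0 < γ) (hT : 0 < Tmax) (hβ : 0 < β) (hη : 0 < η) (hδ : 0 < δ)
    (hζ : 0 < ζ) (hα : 0 < α) (hρ : 0 < ρ) (hμ : 0 < μ) (hc : 0 < c)
    (Ts Is Rs Vs : ℝ)
    (heqT : γ * (1 - (Ts + Is) / Tmax) * Ts - β * Vs * Ts = 0)
    (heqI : β * Vs * Ts + η * γ * (1 - (Ts + Is) / Tmax) * Is - δ * Is = 0)
    (heqR : ζ * β * Vs * Ts + α * Is - (ρ + μ + δ) * Rs = 0)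
    (heqV : ρ * Rs - c * Vs = 0)
    (hTs : 0 < Ts)
    (hMB : ζ * ρ * β * Ts - (ρ + μ + δ) * c ≠ α * ρ * β * Tmax / γ) :
    Is / Tmax =
      (1 - Ts / Tmax) * (ζ * ρ * β * Ts - (ρ + μ + δ) * c) /
        ((ζ * ρ * β * Ts - (ρ + μ + δ) * c) - α * ρ * β * Tmax / γ) := by
  have h1 : γ * (1 - (Ts + Is) / Tmax) = β * Vs := by
    apply mul_right_cancel₀ hTs.ne'
    linarith
  have h2 : (ζ * ρ * β * Ts - (ρ + μ + δ) * c) * Vs + α * ρ * Is = 0 := by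
    linear_combination ρ * heqR + (ρ + μ + δ) * heqV
  rw [eq_div_iff (sub_ne_zero.mpr hMB)]
  rw [add_div] at h1
  have hI : Is = Is / Tmax * Tmax := by field_simp
  have hB : α * ρ * β * Tmax / γ * γ = α * ρ * β * Tmax := by field_simp
  generalize α * ρ * β * Tmax / γ = B at *
  generalize Is / Tmax = x at *
  generalize Ts / Tmax = t at *
  apply mul_left_cancel₀ hγ.ne'
  linear_combination (-(ζ * ρ * β * Ts - (ρ + μ + δ) * c)) * h1 - β * h2 - x * hB
    + α * ρ * β * hI
end

section
/- Let γ, T_max, β, η, δ, ζ, α, ρ, μ, c be positive reals. Suppose (T*, I*, R*, V*) is an equilibrium of the logistic multiscale HCV model with 0 < T* < T_max and M(T*) ≠ B, where M(T) = ζρβT − (ρ+μ+δ)c and B = αρβT_max/γ. Then F(T*) = 0, where F(T) = γBT(M(T)−B) + γBηT_max(1−T/T_max)M(T) + δT_max·M(T)·(M(T)−B). -/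
/-- At any equilibrium of the logistic multiscale HCV model with `0 < T* < T_max` and
`M(T*) ≠ B`, the uninfected hepatocyte concentration satisfies `F(T*) = 0`. -/
theorem stmt_5 (γ Tmax β η δ ζ α ρ μ c : ℝ)
    (hγ : 0 < γ) (hT : 0 < Tmax) (hβ : 0 < β) (hη : 0 < η) (hδ : 0 < δ)
    (hζ : 0 < ζ) (hα : 0 < α) (hρ : 0 < ρ) (hμ : 0 < μ) (hc : 0 < c)
    (M F : ℝ → ℝ) (B : ℝ)
    (hM : ∀ T, M T = ζ * ρ * β * T - (ρ + μ + δ) * c)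
    (hB : B = α * ρ * β * Tmax / γ)
    (hF : ∀ T, F T = γ * B * T * (M T - B) + γ * B * η * Tmax * (1 - T / Tmax) * M T
      + δ * Tmax * M T * (M T - B))
    (Ts Is Rs Vs : ℝ)
    (heqT : γ * (1 - (Ts + Is) / Tmax) * Ts - β * Vs * Ts = 0)
    (heqI : β * Vs * Ts + η * γ * (1 - (Ts + Is) / Tmax) * Is - δ * Is = 0)
    (heqR : ζ * β * Vs * Ts + α * Is - (ρ + μ + δ) * Rs = 0)
    (heqV : ρ * Rs - c * Vs = 0)
    (hTs : 0 < Ts) (hTs' : Ts < Tmax)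
    (hMB : M Ts ≠ B) :
    F Ts = 0 := by
  rw [hF]
  have hm := hM Ts
  generalize M Ts = m at *
  obtain ⟨x, hx⟩ : ∃ x, x = 1 - Ts / Tmax := ⟨_, rfl⟩
  have hxpos : 0 < x := by
    rw [hx, sub_pos, div_lt_one hT]
    exact hTs'
  have hBγ : B * γ = α * ρ * β * Tmax := by
    rw [hB]
    field_simp
  have hV : β * Vs = γ * (1 - (Ts + Is) / Tmax) := by
    apply mul_right_cancel₀ hTs.ne'
    linarith
  have hV2 : β * Vs * Tmax = γ * (x * Tmax - Is) := by
    rw [hV, hx]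
    field_simp
    ring
  have h1 : m * Vs + α * ρ * Is = 0 := by
    rw [hm]
    linear_combination ρ * heqR + (ρ + μ + δ) * heqV
  have h2 : (m - B) * Is = m * x * Tmax := by
    apply mul_left_cancel₀ hγ.ne'
    linear_combination (-β * Tmax) * h1 + m * hV2 - Is * hBγ
  have h3 : (m - B) * (β * Vs) = -(γ * B * x) := by
    apply mul_right_cancel₀ hT.ne'
    linear_combination (m - B) * hV2 - γ * h2
  have h4 : β * Vs * Ts + η * (β * Vs) * Is - δ * Is = 0 := by
    linear_combination heqI + η * Is * hV
  rw [← hx]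
  apply mul_left_cancel₀ hxpos.ne'
  linear_combination (-(m - B) ^ 2) * h4 + (Ts * (m - B)) * h3
    + η * (m - B) * Is * h3 - η * γ * B * x * h2 - δ * (m - B) * h2
end

section
/- Let γ, T_max, β, η, δ, ζ, α, ρ, μ, c be positive reals. With M(T) = ζρβT − (ρ+μ+δ)c, B = αρβT_max/γ, and F(T) = γBT(M(T)−B) + γBηT_max(1−T/T_max)M(T) + δT_max·M(T)·(M(T)−B), one has F(0) = 0 if and only if 𝓡 = 𝓡†, where 𝓡 = βT_max(α+δ)ρ/(δc(δ+μ+ρ)) and 𝓡† = (1/(γη))·(γ + (ρβT_max/(c(ρ+μ+δ)))·(α + γη)). -/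
/-- `F(0) = 0` iff `𝓡 = 𝓡†`: the infected equilibrium coalesces with the total infection
equilibrium in a transcritical bifurcation. -/
theorem stmt_7 (γ Tmax β η δ ζ α ρ μ c : ℝ)
    (hγ : 0 < γ) (hT : 0 < Tmax) (hβ : 0 < β) (hη : 0 < η) (hδ : 0 < δ)
    (hζ : 0 < ζ) (hα : 0 < α) (hρ : 0 < ρ) (hμ : 0 < μ) (hc : 0 < c)
    (M F : ℝ → ℝ) (B R Rdag : ℝ)
    (hM : ∀ T, M T = ζ * ρ * β * T - (ρ + μ + δ) * c)
    (hB : B = α * ρ * β * Tmax / γ)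
    (hF : ∀ T, F T = γ * B * T * (M T - B) + γ * B * η * Tmax * (1 - T / Tmax) * M T
      + δ * Tmax * M T * (M T - B))
    (hR : R = β * Tmax * (α + δ) * ρ / (δ * c * (δ + μ + ρ)))
    (hRdag : Rdag = (1 / (γ * η)) * (γ + (ρ * β * Tmax / (c * (ρ + μ + δ))) * (α + γ * η))) :
    F 0 = 0 ↔ R = Rdag := by
  have hK : 0 < ρ + μ + δ := by positivity
  have hF0 : F 0 = -(Tmax * ((ρ + μ + δ) * c) / γ) *
      (α * (ρ * β * Tmax) * (γ * η - δ) - γ * δ * ((ρ + μ + δ) * c)) := by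
    rw [hF, hM, hB]
    field_simp
    ring
  have hD : R - Rdag = (1 / (γ * η * δ * c * (ρ + μ + δ))) *
      (α * (ρ * β * Tmax) * (γ * η - δ) - γ * δ * ((ρ + μ + δ) * c)) := by
    rw [hR, hRdag, show δ + μ + ρ = ρ + μ + δ by ring]
    have hK' := hK.ne'
    generalize ρ + μ + δ = K at *
    field_simp
    ring
  have h1 : -(Tmax * ((ρ + μ + δ) * c) / γ) ≠ 0 := neg_ne_zero.mpr (by positivity)
  have h2 : 1 / (γ * η * δ * c * (ρ + μ + δ)) ≠ 0 := by positivity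
  rw [← sub_eq_zero (a := R), hF0, hD, mul_eq_zero, mul_eq_zero, or_iff_right h1, or_iff_right h2]
end

section
/- Let γ, T_max, β, η, δ, ζ, α, ρ, μ, c be positive reals. Define k₂ = α(1−η) + δζ, k₃ = α²βρT_max/(γ(ρ+μ+δ)c), and let c₂ = ζρ²β²T_max(α(1−η) + δζ), c₁ = T_max·ζρβ·(ρ+μ+δ)·c·δη·(𝓡 − 𝓡† − 1/η) − (ρ+μ+δ)·c·γB·(1−η) − γB², c₀ = [(ρ+μ+δ)c]²·δ·T_max·η·(𝓡† − 𝓡), with B = αρβT_max/γ, 𝓡 = βT_max(α+δ)ρ/(δc(δ+μ+ρ)), 𝓡† = (1/(γη))·(γ + (ρβT_max/(c(ρ+μ+δ)))·(α + γη)). If 𝓡 = 𝓡†, then c₁² − 4c₀c₂ = [ρβT_max(ρ+μ+δ)c]²·(k₂ + k₃)²; consequently, under 𝓡 = 𝓡†, the discriminant c₁² − 4c₀c₂ vanishes if and only if η = 1 + δζ/α + αβρT_max/(γ(ρ+μ+δ)c). -/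
/-- Under `𝓡 = 𝓡†` the discriminant of the quadratic `F` satisfies
`c₁² − 4c₀c₂ = [ρβT_max(ρ+μ+δ)c]²(k₂+k₃)²`, and it vanishes iff
`η = 1 + δζ/α + αβρT_max/(γ(ρ+μ+δ)c)` (the saddle-node transcritical condition). -/
theorem stmt_9 (γ Tmax β η δ ζ α ρ μ c : ℝ)
    (hγ : 0 < γ) (hT : 0 < Tmax) (hβ : 0 < β) (hη : 0 < η) (hδ : 0 < δ)
    (hζ : 0 < ζ) (hα : 0 < α) (hρ : 0 < ρ) (hμ : 0 < μ) (hc : 0 < c)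
    (B R Rdag c₂ c₁ c₀ k₂ k₃ : ℝ)
    (hB : B = α * ρ * β * Tmax / γ)
    (hR : R = β * Tmax * (α + δ) * ρ / (δ * c * (δ + μ + ρ)))
    (hRdag : Rdag = (1 / (γ * η)) * (γ + (ρ * β * Tmax / (c * (ρ + μ + δ))) * (α + γ * η)))
    (hk₂ : k₂ = α * (1 - η) + δ * ζ)
    (hk₃ : k₃ = α ^ 2 * β * ρ * Tmax / (γ * (ρ + μ + δ) * c))
    (hc₂ : c₂ = ζ * ρ ^ 2 * β ^ 2 * Tmax * (α * (1 - η) + δ * ζ))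
    (hc₁ : c₁ = Tmax * ζ * ρ * β * (ρ + μ + δ) * c * δ * η * (R - Rdag - 1 / η)
      - (ρ + μ + δ) * c * γ * B * (1 - η) - γ * B ^ 2)
    (hc₀ : c₀ = ((ρ + μ + δ) * c) ^ 2 * δ * Tmax * η * (Rdag - R))
    (hRR : R = Rdag) :
    c₁ ^ 2 - 4 * c₀ * c₂ = (ρ * β * Tmax * (ρ + μ + δ) * c) ^ 2 * (k₂ + k₃) ^ 2 ∧
    (c₁ ^ 2 - 4 * c₀ * c₂ = 0 ↔
      η = 1 + δ * ζ / α + α * β * ρ * Tmax / (γ * (ρ + μ + δ) * c)) := by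
  have hS : 0 < ρ + μ + δ := by positivity
  have h1 : c₁ = -(ρ * β * Tmax * (ρ + μ + δ) * c * (k₂ + k₃)) := by
    rw [hc₁, hRR, hB, hk₂, hk₃]
    generalize ρ + μ + δ = S at hS
    field_simp
    ring
  have h0 : c₀ = 0 := by rw [hc₀, hRR]; ring
  have hk : k₂ + k₃ =
      α * (1 + δ * ζ / α + α * β * ρ * Tmax / (γ * (ρ + μ + δ) * c) - η) := by
    rw [hk₂, hk₃]
    generalize ρ + μ + δ = S at hS
    field_simp
    ring
  have hD : c₁ ^ 2 - 4 * c₀ * c₂ =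
      (ρ * β * Tmax * (ρ + μ + δ) * c) ^ 2 * (k₂ + k₃) ^ 2 := by
    rw [h1, h0]; ring
  refine ⟨hD, ?_⟩
  have hP : (ρ * β * Tmax * (ρ + μ + δ) * c) ^ 2 ≠ 0 := by positivity
  rw [hD, mul_eq_zero, or_iff_right hP, pow_eq_zero_iff two_ne_zero, hk, mul_eq_zero,
    or_iff_right hα.ne', sub_eq_zero, eq_comm]
end

section
/- Let γ, T_max, β, η, δ, α, ρ, μ, c be positive reals and set Q = ρβT_max/(c(ρ+μ+δ)). Suppose Q < 1. Then 𝓡† < 1 if and only if η > (1 + αQ/γ)/(1 − Q), where 𝓡† = (1/(γη))·(γ + Q·(α + γη)). In particular, if βT_max < c and η > (1 + αρβT_max/(γc(ρ+μ+δ)))/(1 − ρβT_max/(c(ρ+μ+δ))), then 𝓡† < 1. -/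
/-- With `Q = ρβT_max/(c(ρ+μ+δ)) < 1`, one has `𝓡† < 1` iff `η > (1 + αQ/γ)/(1 − Q)`;
in particular, if `βT_max < c` and `η` exceeds this threshold then `𝓡† < 1`. -/
theorem stmt_11 (γ Tmax β η δ α ρ μ c : ℝ)
    (hγ : 0 < γ) (hT : 0 < Tmax) (hβ : 0 < β) (hη : 0 < η) (hδ : 0 < δ)
    (hα : 0 < α) (hρ : 0 < ρ) (hμ : 0 < μ) (hc : 0 < c)
    (Q Rdag : ℝ)
    (hQ : Q = ρ * β * Tmax / (c * (ρ + μ + δ)))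
    (hQ1 : Q < 1)
    (hRdag : Rdag = (1 / (γ * η)) * (γ + Q * (α + γ * η))) :
    (Rdag < 1 ↔ η > (1 + α * Q / γ) / (1 - Q)) ∧
    (β * Tmax < c →
      η > (1 + α * ρ * β * Tmax / (γ * c * (ρ + μ + δ)))
            / (1 - ρ * β * Tmax / (c * (ρ + μ + δ))) →
      Rdag < 1) := by
  have key : Rdag < 1 ↔ η > (1 + α * Q / γ) / (1 - Q) := by
    have h1 : 0 < 1 - Q := by linarith
    have hr : Rdag = (γ + Q * (α + γ * η)) / (γ * η) := by rw [hRdag]; ring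
    have hs : 1 + α * Q / γ = (γ + α * Q) / γ := by field_simp
    rw [hr, div_lt_one (by positivity), gt_iff_lt, div_lt_iff₀ h1, hs, div_lt_iff₀ hγ]
    constructor <;> intro h <;> nlinarith
  refine ⟨key, fun _ h => key.2 ?_⟩
  have e : α * ρ * β * Tmax / (γ * c * (ρ + μ + δ)) = α * Q / γ := by
    have : ρ + μ + δ ≠ 0 := by positivity
    rw [hQ]; field_simp
  rw [e, ← hQ] at h
  exact h
end

section
/- Let η, δ, b_max > 0, let b : ℝ → ℝ be continuous with 0 ≤ b(t) ≤ b_max for all t, and let I₀ : ℝ → ℝ be continuous and bounded. Set φ(σ) = ηb(σ) − δ and, for n ≥ 1, define I_n(t) = ∫₀^∞ 2ηb(t−s)·I₀(t−s)·exp(∫_{t−s}^t φ(σ)dσ)·g₁ⁿ(∫_{t−s}^t 2ηb(σ)dσ) ds, where g₁ⁿ(x) = x^{n−1}e^{−x}/(n−1)!. Then each I_n is well defined (the integral converges absolutely) and differentiable, and for every n ≥ 1 and every t, I_n'(t) = 2ηb(t)·I_{n−1}(t) − (ηb(t) + δ)·I_n(t), where for n = 1 the term I₀ is the given function. -/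
open MeasureTheory intervalIntegral

theorem aux_tr (f : ℝ → ℝ) (t : ℝ) (hf : IntegrableOn f (Set.Iic t)) :
    IntegrableOn (fun s => f (t - s)) (Set.Ioi 0) ∧
      ∫ s in Set.Ioi (0:ℝ), f (t - s) = ∫ u in Set.Iic t, f u := by
  have hp : (fun s : ℝ => t - s) ⁻¹' (Set.Iio t) = Set.Ioi 0 := by
    ext s; simp
  have mp := Measure.measurePreserving_sub_left (volume : Measure ℝ) t
  have me : MeasurableEmbedding (fun s : ℝ => t - s) :=
    (Homeomorph.subLeft t).measurableEmbedding
  constructor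
  · have h1 : IntegrableOn f (Set.Iio t) := hf.mono_set Set.Iio_subset_Iic_self
    have := (mp.integrableOn_comp_preimage me (f := f) (s := Set.Iio t)).2 h1
    rwa [hp] at this
  · rw [integral_Iic_eq_integral_Iio, ← mp.setIntegral_preimage_emb me f (Set.Iio t), hp]

theorem aux_J (f : ℝ → ℝ) (hc : Continuous f) (hf : ∀ t, IntegrableOn f (Set.Iic t)) (t : ℝ) :
    HasDerivAt (fun t => ∫ u in Set.Iic t, f u) (f t) t := by
  have h : (fun t => ∫ u in Set.Iic t, f u)
      = fun t => (∫ u in Set.Iic (0:ℝ), f u) + ∫ u in (0:ℝ)..t, f u := by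
    funext x
    rw [← integral_Iic_sub_Iic (hf 0) (hf x)]; ring
  rw [h]
  exact (integral_hasDerivAt_right (hc.intervalIntegrable _ _)
    (hc.stronglyMeasurableAtFilter _ _) hc.continuousAt).const_add _

theorem aux_binom (x y : ℝ) (m : ℕ) :
    (x + y) ^ m / (m.factorial : ℝ) =
      ∑ k ∈ Finset.range (m + 1),
        x ^ k / (k.factorial : ℝ) * (y ^ (m - k) / ((m - k).factorial : ℝ)) := by
  rw [add_pow, Finset.sum_div]
  refine Finset.sum_congr rfl fun k hk => ?_
  have hk' : k ≤ m := by simpa [Nat.lt_succ_iff] using hk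
  rw [Nat.cast_choose ℝ hk']
  have h1 : (m.factorial : ℝ) ≠ 0 := by positivity
  have h2 : (k.factorial : ℝ) ≠ 0 := by positivity
  have h3 : ((m - k).factorial : ℝ) ≠ 0 := by positivity
  field_simp

theorem aux_K_eq (h P : ℝ → ℝ)
    (hint : ∀ j : ℕ, ∀ t, IntegrableOn (fun u => h u * ((-P u) ^ j / (j.factorial : ℝ))) (Set.Iic t))
    (m : ℕ) (t x : ℝ) :
    IntegrableOn (fun u => h u * ((x - P u) ^ m / (m.factorial : ℝ))) (Set.Iic t) ∧
    ∫ u in Set.Iic t, h u * ((x - P u) ^ m / (m.factorial : ℝ)) =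
      ∑ k ∈ Finset.range (m + 1), x ^ k / (k.factorial : ℝ) *
        ∫ u in Set.Iic t, h u * ((-P u) ^ (m - k) / ((m - k).factorial : ℝ)) := by
  have he : (fun u => h u * ((x - P u) ^ m / (m.factorial : ℝ))) = fun u =>
      ∑ k ∈ Finset.range (m + 1), x ^ k / (k.factorial : ℝ) *
        (h u * ((-P u) ^ (m - k) / ((m - k).factorial : ℝ))) := by
    funext u
    rw [sub_eq_add_neg, aux_binom, Finset.mul_sum]
    exact Finset.sum_congr rfl fun k _ => by ring
  rw [he]
  have hi : ∀ k ∈ Finset.range (m + 1), Integrable (fun u => x ^ k / (k.factorial : ℝ) *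
        (h u * ((-P u) ^ (m - k) / ((m - k).factorial : ℝ)))) (volume.restrict (Set.Iic t)) :=
    fun k _ => (hint (m - k) t).const_mul _
  refine ⟨integrable_finsetSum _ hi, ?_⟩
  rw [integral_finsetSum _ hi]
  exact Finset.sum_congr rfl fun k _ => integral_const_mul _ _

theorem aux_K (h P p : ℝ → ℝ) (hh : Continuous h) (hP : ∀ t, HasDerivAt P (p t) t)
    (hint : ∀ j : ℕ, ∀ t, IntegrableOn (fun u => h u * ((-P u) ^ j / (j.factorial : ℝ))) (Set.Iic t))
    (m : ℕ) (t : ℝ) :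
    HasDerivAt (fun t => ∫ u in Set.Iic t, h u * ((P t - P u) ^ (m + 1) / ((m + 1).factorial : ℝ)))
      (p t * ∫ u in Set.Iic t, h u * ((P t - P u) ^ m / (m.factorial : ℝ))) t := by
  have hPc : Continuous P := continuous_iff_continuousAt.2 fun t => (hP t).continuousAt
  have hJ : ∀ j : ℕ, HasDerivAt (fun t => ∫ u in Set.Iic t, h u * ((-P u) ^ j / (j.factorial : ℝ)))
      (h t * ((-P t) ^ j / (j.factorial : ℝ))) t := fun j =>
    aux_J _ (by fun_prop) (hint j) t
  have hpow : ∀ k : ℕ, HasDerivAt (fun t => P t ^ k / (k.factorial : ℝ))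
      ((k : ℝ) * P t ^ (k - 1) * p t / (k.factorial : ℝ)) t := fun k =>
    ((hP t).pow k).div_const _
  have e1 : (fun t => ∫ u in Set.Iic t, h u * ((P t - P u) ^ (m + 1) / ((m + 1).factorial : ℝ)))
      = fun t => ∑ k ∈ Finset.range (m + 1 + 1), P t ^ k / (k.factorial : ℝ) *
        ∫ u in Set.Iic t, h u * ((-P u) ^ (m + 1 - k) / ((m + 1 - k).factorial : ℝ)) := by
    funext t
    exact (aux_K_eq h P hint (m + 1) t (P t)).2
  rw [e1, (aux_K_eq h P hint m t (P t)).2]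
  have hd := HasDerivAt.fun_sum (u := Finset.range (m + 1 + 1))
    (fun k _ => (hpow k).mul (hJ (m + 1 - k)))
  refine hd.congr_deriv ?_
  rw [Finset.sum_add_distrib]
  have z : ∑ k ∈ Finset.range (m + 1 + 1), P t ^ k / (k.factorial : ℝ) *
      (h t * ((-P t) ^ (m + 1 - k) / ((m + 1 - k).factorial : ℝ))) = 0 := by
    have := aux_binom (P t) (-P t) (m + 1)
    rw [add_neg_cancel, zero_pow (Nat.succ_ne_zero m), zero_div] at this
    calc _ = h t * ∑ k ∈ Finset.range (m + 1 + 1), P t ^ k / (k.factorial : ℝ) *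
          ((-P t) ^ (m + 1 - k) / ((m + 1 - k).factorial : ℝ)) := by
          rw [Finset.mul_sum]
          exact Finset.sum_congr rfl fun k _ => by ring
      _ = 0 := by rw [← this, mul_zero]
  rw [z, add_zero, Finset.sum_range_succ', Finset.mul_sum]
  simp only [Nat.cast_zero, zero_mul, zero_div, add_zero, Nat.add_sub_add_right, Nat.add_sub_cancel]
  refine Finset.sum_congr rfl fun k _ => ?_
  rw [Nat.factorial_succ]
  have h2 : (k.factorial : ℝ) ≠ 0 := by positivity
  push_cast
  have h3 : (k : ℝ) + 1 ≠ 0 := by positivity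
  field_simp

theorem aux_int (f : ℝ → ℝ) (hc : Continuous f) (C δ : ℝ) (hδ : 0 < δ) (j : ℕ)
    (hf : ∀ u ≤ 0, |f u| ≤ C * ((-u) ^ j * Real.exp (δ * u))) (t : ℝ) :
    IntegrableOn f (Set.Iic t) := by
  have h0 : IntegrableOn (fun s : ℝ => s ^ j * Real.exp (-δ * s)) (Set.Ioi 0) := by
    have := integrableOn_rpow_mul_exp_neg_mul_rpow (s := (j : ℝ)) (p := 1) (b := δ)
      (by have : (0:ℝ) ≤ j := by positivity
          linarith) one_pos hδ
    simpa using this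
  have h1 : IntegrableOn (fun s => f (0 - s)) (Set.Ioi 0) := by
    refine Integrable.mono' (h0.const_mul C) (by fun_prop) ?_
    refine (ae_restrict_iff' measurableSet_Ioi).2 (Filter.Eventually.of_forall fun s hs => ?_)
    have hs' : (0:ℝ) < s := hs
    have := hf (0 - s) (by linarith)
    rw [Real.norm_eq_abs]
    convert this using 4 <;> ring
  have h2 : IntegrableOn f (Set.Iio 0) := by
    have hp : (fun s : ℝ => 0 - s) ⁻¹' (Set.Iio 0) = Set.Ioi 0 := by
      ext s; simp
    have mp := Measure.measurePreserving_sub_left (volume : Measure ℝ) 0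
    have me : MeasurableEmbedding (fun s : ℝ => 0 - s) :=
      (Homeomorph.subLeft (0:ℝ)).measurableEmbedding
    refine (mp.integrableOn_comp_preimage me (f := f) (s := Set.Iio 0)).1 ?_
    rw [hp]; exact h1
  have h3 : IntegrableOn f (Set.Icc 0 t) := hc.continuousOn.integrableOn_Icc
  refine (h2.union h3).mono_set fun x hx => ?_
  rcases lt_or_ge x 0 with h | h
  · exact Or.inl h
  · exact Or.inr ⟨h, hx⟩

/-- The closed-form integral formula for the generation-structured infected-cell populations
is well defined and solves the transit-compartment ODE
`I_n' = 2ηb·I_{n−1} − (ηb + δ)·I_n`. -/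
theorem stmt_14 (η δ bmax : ℝ) (hη : 0 < η) (hδ : 0 < δ) (hbmax : 0 < bmax)
    (b I0 : ℝ → ℝ) (hb : Continuous b) (hb0 : ∀ t, 0 ≤ b t) (hbB : ∀ t, b t ≤ bmax)
    (hI0 : Continuous I0) (hI0b : ∃ C, ∀ t, |I0 t| ≤ C)
    (φ : ℝ → ℝ) (hφ : ∀ σ, φ σ = η * b σ - δ)
    (g : ℕ → ℝ → ℝ)
    (hg : ∀ n : ℕ, ∀ x : ℝ, g n x = x ^ (n - 1) * Real.exp (-x) / (n - 1).factorial)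
    (I : ℕ → ℝ → ℝ)
    (hIzero : ∀ t, I 0 t = I0 t)
    (hI : ∀ n : ℕ, 1 ≤ n → ∀ t, I n t = ∫ s in Set.Ioi (0 : ℝ),
      2 * η * b (t - s) * I0 (t - s) * Real.exp (∫ σ in (t - s)..t, φ σ)
        * g n (∫ σ in (t - s)..t, 2 * η * b σ)) :
    (∀ n : ℕ, 1 ≤ n → ∀ t : ℝ, MeasureTheory.IntegrableOn
      (fun s => 2 * η * b (t - s) * I0 (t - s) * Real.exp (∫ σ in (t - s)..t, φ σ)
        * g n (∫ σ in (t - s)..t, 2 * η * b σ)) (Set.Ioi 0)) ∧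
    (∀ n : ℕ, 1 ≤ n → ∀ t : ℝ, HasDerivAt (I n)
      (2 * η * b t * I (n - 1) t - (η * b t + δ) * I n t) t) := by
  obtain ⟨C, hC⟩ := hI0b
  have hC0 : 0 ≤ C := (abs_nonneg _).trans (hC 0)
  set B : ℝ → ℝ := fun t => ∫ σ in (0:ℝ)..t, b σ with hB
  have hbi : ∀ x y, IntervalIntegrable b volume x y := fun x y => hb.intervalIntegrable x y
  have hBd : ∀ t, HasDerivAt B (b t) t := fun t =>
    integral_hasDerivAt_right (hbi _ _) (hb.stronglyMeasurableAtFilter _ _) hb.continuousAt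
  have hBc : Continuous B := continuous_iff_continuousAt.2 fun t => (hBd t).continuousAt
  have hBsub : ∀ x y, ∫ σ in x..y, b σ = B y - B x := fun x y =>
    (integral_interval_sub_left (hbi 0 y) (hbi 0 x)).symm
  have hB00 : B 0 = 0 := by simp [hB]
  have hBneg : ∀ u ≤ 0, 0 ≤ - B u ∧ -B u ≤ bmax * (-u) := by
    intro u hu
    have e : -B u = ∫ σ in u..0, b σ := by rw [hBsub, hB00]; ring
    rw [e]
    refine ⟨integral_nonneg hu fun x _ => hb0 x, ?_⟩
    have := integral_mono_on hu (hbi u 0) (_root_.intervalIntegrable_const (c := bmax))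
      (fun x _ => hbB x)
    refine this.trans (le_of_eq ?_)
    simp; ring
  set A : ℝ → ℝ := fun t => η * B t + δ * t with hA
  set P : ℝ → ℝ := fun t => 2 * η * B t with hPdef
  obtain ⟨p, hp⟩ : ∃ p : ℝ → ℝ, p = fun t => 2 * η * b t := ⟨_, rfl⟩
  set h : ℝ → ℝ := fun u => 2 * η * b u * I0 u * Real.exp (A u) with hh
  have hAd : ∀ t, HasDerivAt A (η * b t + δ) t := fun t => by
    have := ((hBd t).const_mul η).add ((hasDerivAt_id t).const_mul δ)
    rw [mul_one] at this
    exact this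
  have hAc : Continuous A := continuous_iff_continuousAt.2 fun t => (hAd t).continuousAt
  have hPd : ∀ t, HasDerivAt P (p t) t := fun t => by
    rw [hp]; exact (hBd t).const_mul (2 * η)
  have hPc : Continuous P := continuous_iff_continuousAt.2 fun t => (hPd t).continuousAt
  have hhc : Continuous h := by fun_prop
  have hint : ∀ j : ℕ, ∀ t,
      IntegrableOn (fun u => h u * ((-P u) ^ j / (j.factorial : ℝ))) (Set.Iic t) := by
    intro j t
    refine aux_int _ (by fun_prop)
      (2 * η * bmax * C * ((2 * η * bmax) ^ j / (j.factorial : ℝ))) δ hδ j ?_ t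
    intro u hu
    obtain ⟨h1, h2⟩ := hBneg u hu
    have hP0 : 0 ≤ -P u := by
      have : -P u = 2 * η * (-B u) := by simp only [hPdef]; ring
      rw [this]; positivity
    have hP1 : -P u ≤ 2 * η * bmax * (-u) := by
      have : -P u = 2 * η * (-B u) := by simp only [hPdef]; ring
      rw [this]
      calc 2 * η * (-B u) ≤ 2 * η * (bmax * (-u)) := by gcongr
        _ = _ := by ring
    have hA1 : A u ≤ δ * u := by
      simp only [hA]
      nlinarith
    have hh1 : |h u| ≤ 2 * η * bmax * C * Real.exp (δ * u) := by
      simp only [hh]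
      rw [abs_mul, abs_mul, abs_mul, Real.abs_exp, abs_of_nonneg (hb0 u),
        abs_of_pos (by positivity : 0 < 2 * η)]
      have := hbB u
      have := hC u
      have := hb0 u
      gcongr
    have hpw : (-P u) ^ j ≤ (2 * η * bmax) ^ j * (-u) ^ j := by
      rw [← mul_pow]; gcongr
    have hnn : 0 ≤ (-P u) ^ j / (j.factorial : ℝ) := by positivity
    rw [abs_mul, abs_of_nonneg hnn]
    calc |h u| * ((-P u) ^ j / (j.factorial : ℝ))
        ≤ (2 * η * bmax * C * Real.exp (δ * u)) *
          ((2 * η * bmax) ^ j * (-u) ^ j / (j.factorial : ℝ)) := by gcongr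
      _ = _ := by ring
  have hform : ∀ n t s, 2 * η * b (t - s) * I0 (t - s) * Real.exp (∫ σ in (t - s)..t, φ σ)
        * g n (∫ σ in (t - s)..t, 2 * η * b σ) = (fun u => Real.exp (-A t) *
          (h u * ((P t - P u) ^ (n - 1) / ((n - 1).factorial : ℝ)))) (t - s) := by
    intro n t s
    have e1 : ∫ σ in (t - s)..t, φ σ = η * (B t - B (t - s)) - δ * s := by
      simp only [hφ]
      rw [integral_sub ((hbi _ _).const_mul η) _root_.intervalIntegrable_const,
        intervalIntegral.integral_const_mul, hBsub]
      simp; ring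
    have e2 : ∫ σ in (t - s)..t, 2 * η * b σ = P t - P (t - s) := by
      rw [intervalIntegral.integral_const_mul, hBsub]; simp only [hPdef]; ring
    rw [e1, e2, hg]
    simp only [hh]
    have e3 : Real.exp (η * (B t - B (t - s)) - δ * s) * Real.exp (-(P t - P (t - s)))
        = Real.exp (-A t) * Real.exp (A (t - s)) := by
      rw [← Real.exp_add, ← Real.exp_add]
      congr 1
      simp only [hA, hPdef]; ring
    linear_combination (2 * η * b (t - s) * I0 (t - s) * (P t - P (t - s)) ^ (n - 1)
      / ((n - 1).factorial : ℝ)) * e3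
  have hinte : ∀ (n : ℕ) t, IntegrableOn (fun u => Real.exp (-A t) *
      (h u * ((P t - P u) ^ (n - 1) / ((n - 1).factorial : ℝ)))) (Set.Iic t) := fun n t =>
    (aux_K_eq h P hint (n - 1) t (P t)).1.const_mul _
  have hI' : ∀ m : ℕ, I (m + 1) = fun t => Real.exp (-A t) *
      ∫ u in Set.Iic t, h u * ((P t - P u) ^ m / (m.factorial : ℝ)) := by
    intro m
    funext t
    rw [hI (m + 1) (by omega) t]
    simp only [hform]
    rw [(aux_tr _ t (hinte (m + 1) t)).2, MeasureTheory.integral_const_mul]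
    rfl
  refine ⟨fun n hn t => ?_, fun n hn t => ?_⟩
  · simp only [hform]
    exact (aux_tr _ t (hinte n t)).1
  · have hE : HasDerivAt (fun t => Real.exp (-A t))
        (Real.exp (-A t) * (-(η * b t + δ))) t := (hAd t).neg.exp
    obtain ⟨m, rfl⟩ : ∃ m, n = m + 1 := ⟨n - 1, by omega⟩
    rw [Nat.add_sub_cancel]
    rcases m with _ | m
    · have hK : HasDerivAt (fun t => ∫ u in Set.Iic t,
          h u * ((P t - P u) ^ 0 / (Nat.factorial 0 : ℝ))) (h t) t := by
        have := aux_J h hhc (fun t => by simpa using hint 0 t) t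
        simpa using this
      rw [hIzero, hI' 0]
      refine (hE.mul hK).congr_deriv ?_
      have : Real.exp (-A t) * Real.exp (A t) = 1 := by
        rw [← Real.exp_add]; simp
      simp only [hh]
      linear_combination (2 * η * b t * I0 t) * this
    · have hK := aux_K h P p hhc hPd hint m t
      rw [hI' (m + 1), hI' m]
      refine (hE.mul hK).congr_deriv ?_
      simp only [hp]
      ring
end

section
/- Let β, ζ, α, δ, μ, ρ, η be real numbers and let V, T, b : ℝ → ℝ and I_n, R_n : ℝ → ℝ (n = 0, 1, …, N) be differentiable functions satisfying I₀' = βVT − ηbI₀ − δI₀, I_n' = 2ηbI_{n−1} − ηbI_n − δI_n for 1 ≤ n ≤ N, R₀' = ζβVT + αI₀ − (δ+μ+ρ)R₀, and R_n' = αI_n − (δ+μ+ρ)R_n for 1 ≤ n ≤ N. Then the partial sums J_N = ∑_{n=0}^N I_n and P_N = ∑_{n=0}^N R_n satisfy J_N'(t) = βV(t)T(t) + ηb(t)J_N(t) − δJ_N(t) − 2ηb(t)I_N(t) and P_N'(t) = ζβV(t)T(t) + αJ_N(t) − (δ+μ+ρ)P_N(t) for all t. -/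
/-- Telescoping identities for the partial sums `J_N = ∑_{n=0}^N I_n` and
`P_N = ∑_{n=0}^N R_n` of the generational infected-hepatocyte and intracellular
viral RNA concentrations. -/
theorem stmt_16 (β ζ α δ μ ρ η : ℝ) (N : ℕ)
    (V T b : ℝ → ℝ) (I R : ℕ → ℝ → ℝ)
    (hV : Differentiable ℝ V) (hT : Differentiable ℝ T) (hb : Differentiable ℝ b)
    (hIdiff : ∀ n ≤ N, Differentiable ℝ (I n))
    (hRdiff : ∀ n ≤ N, Differentiable ℝ (R n))
    (hI0 : ∀ t, HasDerivAt (I 0)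
      (β * V t * T t - η * b t * I 0 t - δ * I 0 t) t)
    (hIn : ∀ n : ℕ, 1 ≤ n → n ≤ N → ∀ t, HasDerivAt (I n)
      (2 * η * b t * I (n - 1) t - η * b t * I n t - δ * I n t) t)
    (hR0 : ∀ t, HasDerivAt (R 0)
      (ζ * β * V t * T t + α * I 0 t - (δ + μ + ρ) * R 0 t) t)
    (hRn : ∀ n : ℕ, 1 ≤ n → n ≤ N → ∀ t, HasDerivAt (R n)
      (α * I n t - (δ + μ + ρ) * R n t) t) :
    (∀ t, HasDerivAt (fun t => ∑ n ∈ Finset.range (N + 1), I n t)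
      (β * V t * T t + η * b t * (∑ n ∈ Finset.range (N + 1), I n t)
        - δ * (∑ n ∈ Finset.range (N + 1), I n t) - 2 * η * b t * I N t) t) ∧
    (∀ t, HasDerivAt (fun t => ∑ n ∈ Finset.range (N + 1), R n t)
      (ζ * β * V t * T t + α * (∑ n ∈ Finset.range (N + 1), I n t)
        - (δ + μ + ρ) * (∑ n ∈ Finset.range (N + 1), R n t)) t) := by
  clear hV hT hb hIdiff hRdiff
  induction N with
  | zero =>
    refine ⟨fun t => ?_, fun t => ?_⟩
    · simp only [zero_add, Finset.sum_range_one]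
      exact (hI0 t).congr_deriv (by ring)
    · simp only [zero_add, Finset.sum_range_one]
      exact hR0 t
  | succ k ih =>
    obtain ⟨h1, h2⟩ := ih (fun n a c => hIn n a (by omega)) (fun n a c => hRn n a (by omega))
    refine ⟨fun t => ?_, fun t => ?_⟩
    · have h := (h1 t).fun_add (hIn (k + 1) (by omega) le_rfl t)
      simp only [Finset.sum_range_succ _ (k + 1)]
      refine h.congr_deriv ?_
      rw [Nat.add_sub_cancel]
      ring
    · have h := (h2 t).fun_add (hRn (k + 1) (by omega) le_rfl t)
      simp only [Finset.sum_range_succ _ (k + 1)]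
      refine h.congr_deriv ?_
      ring
end

section
/- Let β, η, δ be real numbers, let b, V, T : ℝ → ℝ be continuous with b bounded, and suppose for each N ∈ ℕ that J_N, I_N : ℝ → ℝ are differentiable with J_N'(t) = βV(t)T(t) + ηb(t)J_N(t) − δJ_N(t) − 2ηb(t)I_N(t) for all t. Assume J_N converges to a function I uniformly on every compact interval and I_N converges to 0 uniformly on every compact interval. Then I is differentiable and I'(t) = βV(t)T(t) + ηb(t)I(t) − δI(t) for all t. -/
/-- Interchange of differentiation and summation: if the partial sums `J_N` satisfy the
truncated infected-cell equations and converge uniformly on compacts to `I`, while `I_N → 0`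
uniformly on compacts, then `I` satisfies `I' = βVT + ηbI − δI`. -/
theorem stmt_18 (β η δ : ℝ) (b V T : ℝ → ℝ) (bmax : ℝ)
    (hb : Continuous b) (hbB : ∀ t, |b t| ≤ bmax)
    (hV : Continuous V) (hT : Continuous T)
    (J I : ℕ → ℝ → ℝ) (Ilim : ℝ → ℝ)
    (hJdiff : ∀ N : ℕ, Differentiable ℝ (J N))
    (hIdiff : ∀ N : ℕ, Differentiable ℝ (I N))
    (hJ' : ∀ N : ℕ, ∀ t : ℝ, HasDerivAt (J N)
      (β * V t * T t + η * b t * J N t - δ * J N t - 2 * η * b t * I N t) t)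
    (hJconv : ∀ K : Set ℝ, IsCompact K →
      TendstoUniformlyOn (fun N => J N) Ilim Filter.atTop K)
    (hIconv : ∀ K : Set ℝ, IsCompact K →
      TendstoUniformlyOn (fun N => I N) 0 Filter.atTop K) :
    ∀ t : ℝ, HasDerivAt Ilim (β * V t * T t + η * b t * Ilim t - δ * Ilim t) t := by
  intro t
  have hK : IsCompact (Set.Icc (t - 1) (t + 1)) := isCompact_Icc
  have h1 := Metric.tendstoUniformlyOn_iff.1 (hJconv _ hK)
  have h2 := Metric.tendstoUniformlyOn_iff.1 (hIconv _ hK)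
  have hB : 0 ≤ bmax := (abs_nonneg _).trans (hbB 0)
  refine hasDerivAt_of_tendstoUniformlyOn (l := Filter.atTop) (f := J)
    (f' := fun N t => β * V t * T t + η * b t * J N t - δ * J N t - 2 * η * b t * I N t)
    (g' := fun t => β * V t * T t + η * b t * Ilim t - δ * Ilim t)
    (s := Set.Ioo (t - 1) (t + 1)) isOpen_Ioo ?_ (Filter.Eventually.of_forall fun N x _ => hJ' N x)
    (fun x hx => (hJconv _ hK).tendsto_at (Set.Ioo_subset_Icc_self hx)) (by simp)
  rw [Metric.tendstoUniformlyOn_iff]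
  intro ε hε
  have hC : 0 < 3 * (|η| * bmax) + |δ| + 1 := by positivity
  obtain ⟨e, he, heq⟩ : ∃ e : ℝ, 0 < e ∧ (3 * (|η| * bmax) + |δ| + 1) * e = ε :=
    ⟨ε / (3 * (|η| * bmax) + |δ| + 1), by positivity, by field_simp⟩
  filter_upwards [h1 e he, h2 e he] with N hN1 hN2 x hx
  have a1 := hN1 x (Set.Ioo_subset_Icc_self hx)
  have a2 := hN2 x (Set.Ioo_subset_Icc_self hx)
  simp only [Real.dist_eq, Pi.zero_apply, zero_sub, abs_neg] at a1 a2 ⊢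
  have e1 : β * V x * T x + η * b x * Ilim x - δ * Ilim x -
      (β * V x * T x + η * b x * J N x - δ * J N x - 2 * η * b x * I N x)
      = η * b x * (Ilim x - J N x) - δ * (Ilim x - J N x) + 2 * (η * b x * I N x) := by ring
  have b1 : |η * b x * (Ilim x - J N x)| ≤ |η| * bmax * e := by
    rw [abs_mul, abs_mul]
    gcongr
    exact hbB x
  have b2 : |δ * (Ilim x - J N x)| ≤ |δ| * e := by
    rw [abs_mul]
    gcongr
  have b3 : |η * b x * I N x| ≤ |η| * bmax * e := by
    rw [abs_mul, abs_mul]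
    gcongr
    exact hbB x
  rw [e1, abs_lt]
  rw [abs_le] at b1 b2 b3
  constructor <;> linarith [b1.1, b1.2, b2.1, b2.2, b3.1, b3.2]
end

section
/- Let β, δ, μ, ρ, α > 0 and ζ ≥ 0, let b, h : ℝ or [0,∞) → [0,∞) be continuous and bounded, and let V, T : ℝ → ℝ be continuous. Suppose i₀, i_p : ℝ × [0,∞) → [0,∞) and r₀, r_p : ℝ × [0,∞) → ℝ are continuously differentiable and satisfy, for all t and all a ≥ 0: (∂_t + ∂_a)i₀ = −(δ + b(t)h(a))i₀, (∂_t + ∂_a)i_p = −(δ + b(t)h(a))i_p, (∂_t + ∂_a)r₀ = α − (μ+ρ)r₀, (∂_t + ∂_a)r_p = α − (μ+ρ)r_p, together with the boundary conditions i₀(t,0) = βV(t)T(t), r₀(t,0) = ζ, i_p(t,0) = 2∫₀^∞ b(t)h(a)(i₀(t,a) + i_p(t,a))da, and, whenever ∫₀^∞ b(t)h(a)(i₀(t,a)+i_p(t,a))da > 0, r_p(t,0) = (1/2)·[∫₀^∞ b(t)h(a)(r₀(t,a)i₀(t,a) + r_p(t,a)i_p(t,a))da] / [∫₀^∞ b(t)h(a)(i₀(t,a)+i_p(t,a))da].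 Assume further that for each t the functions a ↦ i₀ + i_p, a ↦ r₀i₀ + r_p i_p and their partial derivatives in t are integrable on (0,∞) and locally in t dominated by a fixed integrable function of a, and that r₀(t,a)i₀(t,a) + r_p(t,a)i_p(t,a) → 0 as a → ∞. Then R(t) = ∫₀^∞ (r₀(t,a)i₀(t,a) + r_p(t,a)i_p(t,a))da is differentiable and R'(t) = ζβV(t)T(t) + αI(t) − (δ+μ+ρ)R(t), where I(t) = ∫₀^∞(i₀(t,a) + i_p(t,a))da. -/
open MeasureTheory

/-- Reduction of the multiscale PDE model of HCV infection with infected-cell proliferation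
and inheritance of intracellular viral RNA: the total intracellular viral RNA
`R(t) = ∫₀^∞ (r₀i₀ + r_p i_p) da` satisfies `R' = ζβVT + αI − (δ+μ+ρ)R`,
where `I(t) = ∫₀^∞ (i₀ + i_p) da`. Here functions of `(t, a)` are maps on `ℝ × ℝ`, with
first coordinate time and second coordinate infection age, and `(∂_t + ∂_a)f(t,a)` is the
directional derivative `fderiv ℝ f (t,a) (1,1)`. -/
theorem stmt_19 (β δ μ ρ α ζ : ℝ)
    (hβ : 0 < β) (hδ : 0 < δ) (hμ : 0 < μ) (hρ : 0 < ρ) (hα : 0 < α) (hζ : 0 ≤ ζ)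
    (b h : ℝ → ℝ) (hbcont : Continuous b) (hhcont : Continuous h)
    (hbnn : ∀ t, 0 ≤ b t) (hhnn : ∀ a, 0 ≤ h a)
    (hbbd : ∃ C, ∀ t, b t ≤ C) (hhbd : ∃ C, ∀ a, h a ≤ C)
    (V T : ℝ → ℝ) (hV : Continuous V) (hT : Continuous T)
    (i0 ip r0 rp : ℝ × ℝ → ℝ)
    (hi0C : ContDiff ℝ 1 i0) (hipC : ContDiff ℝ 1 ip)
    (hr0C : ContDiff ℝ 1 r0) (hrpC : ContDiff ℝ 1 rp)
    (hi0nn : ∀ t a : ℝ, 0 ≤ a → 0 ≤ i0 (t, a)) (hipnn : ∀ t a : ℝ, 0 ≤ a → 0 ≤ ip (t, a))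
    -- the transport PDEs
    (hpde_i0 : ∀ t a : ℝ, 0 ≤ a →
      fderiv ℝ i0 (t, a) (1, 1) = -(δ + b t * h a) * i0 (t, a))
    (hpde_ip : ∀ t a : ℝ, 0 ≤ a →
      fderiv ℝ ip (t, a) (1, 1) = -(δ + b t * h a) * ip (t, a))
    (hpde_r0 : ∀ t a : ℝ, 0 ≤ a →
      fderiv ℝ r0 (t, a) (1, 1) = α - (μ + ρ) * r0 (t, a))
    (hpde_rp : ∀ t a : ℝ, 0 ≤ a →
      fderiv ℝ rp (t, a) (1, 1) = α - (μ + ρ) * rp (t, a))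
    -- the boundary conditions
    (hbc_i0 : ∀ t : ℝ, i0 (t, 0) = β * V t * T t)
    (hbc_r0 : ∀ t : ℝ, r0 (t, 0) = ζ)
    (hbc_ip : ∀ t : ℝ, ip (t, 0) =
      2 * ∫ a in Set.Ioi (0 : ℝ), b t * h a * (i0 (t, a) + ip (t, a)))
    (hbc_rp : ∀ t : ℝ,
      0 < (∫ a in Set.Ioi (0 : ℝ), b t * h a * (i0 (t, a) + ip (t, a))) →
      rp (t, 0) = (1 / 2) *
        ((∫ a in Set.Ioi (0 : ℝ), b t * h a * (r0 (t, a) * i0 (t, a) + rp (t, a) * ip (t, a)))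
          / (∫ a in Set.Ioi (0 : ℝ), b t * h a * (i0 (t, a) + ip (t, a)))))
    -- integrability of the age profiles and of their partial derivatives in time
    (hintG : ∀ t : ℝ, IntegrableOn (fun a => i0 (t, a) + ip (t, a)) (Set.Ioi 0))
    (hintF : ∀ t : ℝ,
      IntegrableOn (fun a => r0 (t, a) * i0 (t, a) + rp (t, a) * ip (t, a)) (Set.Ioi 0))
    (hintG' : ∀ t : ℝ, IntegrableOn
      (fun a => fderiv ℝ (fun p : ℝ × ℝ => i0 p + ip p) (t, a) (1, 0)) (Set.Ioi 0))
    (hintF' : ∀ t : ℝ, IntegrableOn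
      (fun a => fderiv ℝ (fun p : ℝ × ℝ => r0 p * i0 p + rp p * ip p) (t, a) (1, 0))
      (Set.Ioi 0))
    -- local-in-time domination by a fixed integrable function of age
    (hdom : ∀ t0 : ℝ, ∃ ε > 0, ∃ G : ℝ → ℝ, IntegrableOn G (Set.Ioi 0) ∧
      ∀ t : ℝ, |t - t0| < ε → ∀ a : ℝ, 0 < a →
        |i0 (t, a) + ip (t, a)| ≤ G a ∧
        |r0 (t, a) * i0 (t, a) + rp (t, a) * ip (t, a)| ≤ G a ∧
        |fderiv ℝ (fun p : ℝ × ℝ => i0 p + ip p) (t, a) (1, 0)| ≤ G a ∧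
        |fderiv ℝ (fun p : ℝ × ℝ => r0 p * i0 p + rp p * ip p) (t, a) (1, 0)| ≤ G a)
    -- the RNA-weighted density vanishes at large infection age
    (hvanish : ∀ t : ℝ, Filter.Tendsto
      (fun a => r0 (t, a) * i0 (t, a) + rp (t, a) * ip (t, a)) Filter.atTop (nhds 0)) :
    ∀ t : ℝ, HasDerivAt
      (fun t => ∫ a in Set.Ioi (0 : ℝ), r0 (t, a) * i0 (t, a) + rp (t, a) * ip (t, a))
      (ζ * β * V t * T t + α * (∫ a in Set.Ioi (0 : ℝ), i0 (t, a) + ip (t, a))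
        - (δ + μ + ρ) * (∫ a in Set.Ioi (0 : ℝ), r0 (t, a) * i0 (t, a) + rp (t, a) * ip (t, a)))
      t := by
  intro t
  set F : ℝ × ℝ → ℝ := fun p => r0 p * i0 p + rp p * ip p with hF
  have di0 := hi0C.differentiable one_ne_zero
  have dip := hipC.differentiable one_ne_zero
  have dr0 := hr0C.differentiable one_ne_zero
  have drp := hrpC.differentiable one_ne_zero
  have hFC : ContDiff ℝ 1 F := (hr0C.mul hi0C).add (hrpC.mul hipC)
  have dF := hFC.differentiable one_ne_zero
  have hF11 : ∀ a : ℝ, 0 ≤ a → fderiv ℝ F (t, a) (1, 1) =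
      α * (i0 (t, a) + ip (t, a)) - (δ + μ + ρ) * F (t, a) - b t * h a * F (t, a) := by
    intro a ha
    have h1 := (((dr0 (t, a)).hasFDerivAt.mul (di0 (t, a)).hasFDerivAt).add
      ((drp (t, a)).hasFDerivAt.mul (dip (t, a)).hasFDerivAt)).fderiv
    have h2 : fderiv ℝ F (t, a) = _ := h1
    rw [h2]
    simp only [add_apply, smul_apply, smul_eq_mul,
      hpde_i0 t a ha, hpde_ip t a ha, hpde_r0 t a ha, hpde_rp t a ha, hF]
    ring
  have hsplit : ∀ a : ℝ, fderiv ℝ F (t, a) (0, 1) =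
      fderiv ℝ F (t, a) (1, 1) - fderiv ℝ F (t, a) (1, 0) := by
    intro a
    rw [← map_sub]
    simp
  have hda : ∀ a : ℝ, HasDerivAt (fun a => F (t, a)) (fderiv ℝ F (t, a) (0, 1)) a := by
    intro a
    exact (dF (t, a)).hasFDerivAt.comp_hasDerivAt a
      ((hasDerivAt_const a t).prodMk (hasDerivAt_id a))
  have hdt : ∀ s a : ℝ, HasDerivAt (fun s => F (s, a)) (fderiv ℝ F (s, a) (1, 0)) s := by
    intro s a
    exact (dF (s, a)).hasFDerivAt.comp_hasDerivAt s
      ((hasDerivAt_id s).prodMk (hasDerivAt_const s a))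
  obtain ⟨C, hC⟩ := hhbd
  have hbdd : ∀ g : ℝ → ℝ, IntegrableOn g (Set.Ioi 0) →
      IntegrableOn (fun a => b t * h a * g a) (Set.Ioi 0) := by
    intro g hg
    refine Integrable.bdd_mul (c := b t * C) hg
      (continuous_const.mul hhcont).aestronglyMeasurable (Filter.Eventually.of_forall ?_)
    intro a
    rw [Real.norm_eq_abs, abs_of_nonneg (mul_nonneg (hbnn t) (hhnn a))]
    exact mul_le_mul_of_nonneg_left (hC a) (hbnn t)
  have hbG := hbdd _ (hintG t)
  have hbF := hbdd _ (hintF t)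
  have hFt : IntegrableOn (fun a => F (t, a)) (Set.Ioi 0) := hintF t
  have hbF' : IntegrableOn (fun a => b t * h a * F (t, a)) (Set.Ioi 0) := hbF
  have hB : F (t, 0) = ζ * β * V t * T t + ∫ a in Set.Ioi (0 : ℝ), b t * h a * F (t, a) := by
    have hprod : rp (t, 0) * ip (t, 0) = ∫ a in Set.Ioi (0 : ℝ), b t * h a * F (t, a) := by
      have hnn : ∀ a ∈ Set.Ioi (0 : ℝ), 0 ≤ b t * h a * (i0 (t, a) + ip (t, a)) := by
        intro a ha
        have ha' : 0 ≤ a := le_of_lt ha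
        exact mul_nonneg (mul_nonneg (hbnn t) (hhnn a))
          (add_nonneg (hi0nn t a ha') (hipnn t a ha'))
      have hJ := setIntegral_nonneg measurableSet_Ioi hnn (μ := volume)
      rcases hJ.lt_or_eq with hpos | hz
      · rw [hbc_rp t hpos, hbc_ip t]
        have := hpos.ne'
        simp only [hF]
        field_simp
      · rw [hbc_ip t, ← hz]
        have hae := (setIntegral_eq_zero_iff_of_nonneg_ae
          ((ae_restrict_mem measurableSet_Ioi).mono hnn) hbG).1 hz.symm
        symm
        rw [mul_zero, mul_zero]
        apply integral_eq_zero_of_ae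
        filter_upwards [hae, ae_restrict_mem measurableSet_Ioi] with a h1 h2
        have ha' : 0 ≤ a := le_of_lt h2
        have e1 := hi0nn t a ha'
        have e2 := hipnn t a ha'
        simp only [Pi.zero_apply] at h1 ⊢
        rcases mul_eq_zero.1 h1 with h3 | h3
        · rw [h3, zero_mul]
        · have e3 : i0 (t, a) = 0 := by linarith
          have e4 : ip (t, a) = 0 := by linarith
          simp [hF, e3, e4]
    rw [← hprod]
    simp only [hF, hbc_i0, hbc_r0]
    ring
  have hI11 : IntegrableOn (fun a => α * (i0 (t, a) + ip (t, a)) - (δ + μ + ρ) * F (t, a)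
      - b t * h a * F (t, a)) (Set.Ioi 0) :=
    (((hintG t).const_mul α).sub (hFt.const_mul _)).sub hbF'
  have hI2 : IntegrableOn (fun a => α * (i0 (t, a) + ip (t, a)) - (δ + μ + ρ) * F (t, a))
      (Set.Ioi 0) := ((hintG t).const_mul α).sub (hFt.const_mul _)
  have heq : Set.EqOn (fun a => fderiv ℝ F (t, a) (0, 1))
      (fun a => (α * (i0 (t, a) + ip (t, a)) - (δ + μ + ρ) * F (t, a)
      - b t * h a * F (t, a)) - fderiv ℝ F (t, a) (1, 0)) (Set.Ioi 0) := by
    intro a ha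
    simp only [hsplit a, hF11 a (le_of_lt ha)]
  have hF't : IntegrableOn (fun a => fderiv ℝ F (t, a) (1, 0)) (Set.Ioi 0) := hintF' t
  have hI01 : IntegrableOn (fun a => fderiv ℝ F (t, a) (0, 1)) (Set.Ioi 0) :=
    (integrableOn_congr_fun heq measurableSet_Ioi).2 (hI11.sub hF't)
  have hFTC := integral_Ioi_of_hasDerivAt_of_tendsto' (fun a _ => hda a) hI01 (hvanish t)
  have hcalc : ∫ a in Set.Ioi (0 : ℝ), fderiv ℝ F (t, a) (1, 0) =
      ζ * β * V t * T t + α * (∫ a in Set.Ioi (0 : ℝ), i0 (t, a) + ip (t, a))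
        - (δ + μ + ρ) * (∫ a in Set.Ioi (0 : ℝ), F (t, a)) := by
    rw [setIntegral_congr_fun measurableSet_Ioi heq, integral_sub hI11 hF't,
      integral_sub hI2 hbF',
      integral_sub ((hintG t).const_mul α) (hFt.const_mul _),
      integral_const_mul, integral_const_mul, hB] at hFTC
    linarith
  obtain ⟨ε, hε, G, hG, hdomt⟩ := hdom t
  have key := (hasDerivAt_integral_of_dominated_loc_of_deriv_le
    (μ := volume.restrict (Set.Ioi (0 : ℝ))) (F := fun s a => F (s, a))
    (F' := fun s a => fderiv ℝ F (s, a) (1, 0)) (x₀ := t) (bound := G)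
    (Metric.ball_mem_nhds t hε)
    (Filter.Eventually.of_forall fun s => (hintF s).aestronglyMeasurable)
    (hintF t) (hintF' t).aestronglyMeasurable
    (by
      filter_upwards [ae_restrict_mem measurableSet_Ioi] with a ha s hs
      exact (hdomt s (by simpa [Real.dist_eq] using hs) a ha).2.2.2)
    hG
    (Filter.Eventually.of_forall fun a s _ => hdt s a)).2
  rw [hcalc] at key
  exact key
end
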